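/- arXiv:1008.3093 — 2 statements merged into one kernel-verified Lean document; each statement's English description precedes it below -/
import Mathlib

section
/- For every natural number n, the following identity of polynomials in q holds: (1-q)^n · Σ_{M ∈ M_{2n}} q^{cro(M)} = Σ_{k=0}^{n} (-1)^k · (C(2n, n-k) - C(2n, n-k-1)) · q^{k(k+1)/2}, where C(·,·) denotes the binomial coefficient (with C(m, j) = 0 for j < 0). -/
open Polynomial Finset

/-- The binomial coefficient with integer lower argument, zero on negative arguments. -/
def ch (m : ℕ) (j : ℤ) : ℤ := if 0 ≤ j then m.choose j.toNat else 0

/-- A matching of `{1, …, m}`, encoded as a fixed-point-free involution: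
its blocks are the pairs `{i, σ i}`. -/
abbrev IsMatching {m : ℕ} (σ : Equiv.Perm (Fin m)) : Prop :=
  (∀ i, σ (σ i) = i) ∧ ∀ i, σ i ≠ i

/-- The number of crossings of a matching: pairs of blocks `{i,j}`, `{k,l}`
with `i < k < j < l`, counted as pairs `(i,k)` with `i < k < σ i < σ k`. -/
def cro {m : ℕ} (σ : Equiv.Perm (Fin m)) : ℕ :=
  (Finset.univ.filter (fun p : Fin m × Fin m =>
    p.1 < p.2 ∧ p.2 < σ p.1 ∧ σ p.1 < σ p.2)).card

namespace TR

def fixs {m : ℕ} (σ : Equiv.Perm (Fin m)) : Finset (Fin m) := univ.filter (fun i => σ i = i)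

def w {m : ℕ} (σ : Equiv.Perm (Fin m)) : ℕ :=
  (Finset.univ.filter (fun p : Fin m × Fin m =>
    p.1 < p.2 ∧ p.2 < σ p.1 ∧ (σ p.1 < σ p.2 ∨ σ p.2 = p.2))).card

noncomputable def T (m h : ℕ) : Polynomial ℤ :=
  ∑ σ : Equiv.Perm (Fin m), if (∀ i, σ (σ i) = i) ∧ (fixs σ).card = h then X ^ w σ else 0

/-! algebra -/

noncomputable def G : ℕ → ℕ → Polynomial ℤ
  | 0, _ => 1
  | _+1, 0 => 1
  | h+1, k+1 => G h (k+1) + X ^ (h+1) * G (h+1) k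

lemma G_zero (h : ℕ) : G h 0 = 1 := by cases h <;> simp [G]
lemma G_zero' (k : ℕ) : G 0 k = 1 := by simp [G]
lemma G_rec (h k : ℕ) : G (h+1) (k+1) = G h (k+1) + X ^ (h+1) * G (h+1) k := by
  rw [G]

lemma PQ (h : ℕ) : (∀ k, (1 - X ^ (h+k+1)) * G h k = (1 - X^(k+1)) * G h (k+1)) ∧
    (∀ k, (1 - X ^ (h+k+1)) * G h k = (1 - X^(h+1)) * G (h+1) k) := by
  have key : ∀ h, (∀ k, (1 - X ^ (h+k+1)) * G h k = (1 - X^(k+1)) * G h (k+1)) →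
    (∀ k, (1 - X ^ (h+k+1)) * G h k = (1 - X^(h+1)) * G (h+1) k) := by
    intro h Q k
    induction k with
    | zero => simp [G_zero]
    | succ k ih =>
      rw [G_rec]
      have := Q k
      linear_combination X^(h+1) * ih - X^(h+1) * this
  have Q : ∀ h, (∀ k, (1 - X ^ (h+k+1)) * G h k = (1 - X^(k+1)) * G h (k+1)) := by
    intro h
    induction h with
    | zero => intro k; simp [G_zero']
    | succ h ih =>
      intro k
      have P := key h ih k
      rw [G_rec]
      linear_combination ih k - P
  exact ⟨Q h, key h (Q h)⟩

lemma ch_succ (m : ℕ) (j : ℤ) : ch (m+1) j = ch m j + ch m (j-1) := by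
  unfold ch
  rcases lt_trichotomy j 0 with h | h | h
  · rw [if_neg (by omega), if_neg (by omega), if_neg (by omega)]; simp
  · subst h; simp
  · obtain ⟨n, rfl⟩ : ∃ n : ℕ, j = n + 1 := ⟨(j-1).toNat, by omega⟩
    rw [if_pos (by omega), if_pos (by omega), if_pos (by omega)]
    have h1 : ((n:ℤ)+1).toNat = n+1 := by omega
    have h2 : ((n:ℤ)+1-1).toNat = n := by omega
    rw [h1, h2, Nat.choose_succ_succ]; push_cast; ring

def B (m : ℕ) (j : ℤ) : ℤ := ch m j - ch m (j-1)

lemma B_succ (m : ℕ) (j : ℤ) : B (m+1) j = B m j + B m (j-1) := by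
  unfold B; rw [ch_succ, ch_succ]; ring

lemma B_neg (m : ℕ) (j : ℤ) (h : j < 0) : B m j = 0 := by
  unfold B ch; rw [if_neg (by omega), if_neg (by omega)]; simp

lemma B_zero (m : ℕ) : B m 0 = 1 := by simp [B, ch]

lemma B_mid (d : ℕ) : B (2*d+1) (d+1) = 0 := by
  unfold B ch
  rw [if_pos (by omega), if_pos (by omega)]
  have h1 : ((d:ℤ)+1).toNat = d+1 := by omega
  have h2 : ((d:ℤ)+1-1).toNat = d := by omega
  rw [h1, h2, Nat.choose_symm_half]; simp

noncomputable def a (k : ℕ) : Polynomial ℤ := (-1) ^ k * X ^ (k*(k+1)/2)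

lemma a_succ (k : ℕ) : a (k+1) = - X^(k+1) * a k := by
  unfold a
  have : (k+1)*(k+1+1)/2 = k*(k+1)/2 + (k+1) := by
    rw [show (k+1)*(k+1+1) = k*(k+1) + (k+1)*2 by ring, Nat.add_mul_div_right _ _ (by norm_num)]
  rw [this]; ring

noncomputable def V (d h : ℕ) : Polynomial ℤ :=
  ∑ k ∈ range (d+1), a k * (B (2*d+h) ((d:ℤ)-k) : Polynomial ℤ) * G h k

lemma V_zero (h : ℕ) : V 0 h = 1 := by
  simp [V, B_zero, G_zero, a]

lemma V_rec (d h : ℕ) : V (d+1) (h+1) = V (d+1) h + (1 - X^(h+2)) * V d (h+2) := by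
  unfold V
  have e1 : ∀ k : ℕ, (B (2*(d+1)+(h+1)) (((d+1:ℕ):ℤ)-k) : Polynomial ℤ) =
      (B (2*(d+1)+h) (((d+1:ℕ):ℤ)-k) : Polynomial ℤ) + (B (2*(d+1)+h) ((d:ℤ)-k) : Polynomial ℤ) := by
    intro k
    rw [← add_assoc, B_succ]
    push_cast
    congr 3; ring
  simp only [e1]
  simp only [mul_add (a _), add_mul, sum_add_distrib]
  rw [sum_range_succ (fun k => a k * (B (2*(d+1)+h) ((d:ℤ)-k) : Polynomial ℤ) * G (h+1) k) (d+1)]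
  rw [B_neg _ _ (by push_cast; omega)]
  rw [sum_range_succ' _ (d+1), sum_range_succ' _ (d+1), mul_sum]
  have e2 : ∀ k : ℕ, (((d+1:ℕ):ℤ) - ((k+1:ℕ):ℤ)) = (d:ℤ) - k := by intro k; push_cast; ring
  simp only [e2, G_zero, show 2*d+(h+2) = 2*(d+1)+h by ring]
  have : ∀ k ∈ range (d+1), a (k+1) * (B (2*(d+1)+h) ((d:ℤ)-k) : Polynomial ℤ) * G (h+1) (k+1)
     + a k * (B (2*(d+1)+h) ((d:ℤ)-k) : Polynomial ℤ) * G (h+1) k =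
     a (k+1) * (B (2*(d+1)+h) ((d:ℤ)-k) : Polynomial ℤ) * G h (k+1) +
     (1 - X^(h+2)) * (a k * (B (2*(d+1)+h) ((d:ℤ)-k) : Polynomial ℤ) * G (h+2) k) := by
    intro k _
    have P := (PQ (h+1)).2 k
    rw [G_rec, a_succ]
    linear_combination a k * (B (2*(d+1)+h) ((d:ℤ)-k) : Polynomial ℤ) * P
  have := sum_congr rfl this
  rw [sum_add_distrib, sum_add_distrib] at this
  push_cast
  linear_combination this

lemma V_rec0 (d : ℕ) : V (d+1) 0 = (1 - X) * V d 1 := by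
  unfold V
  have e1 : ∀ k : ℕ, (B (2*(d+1)+0) (((d+1:ℕ):ℤ)-k) : Polynomial ℤ) =
      (B (2*d+1) (((d+1:ℕ):ℤ)-k) : Polynomial ℤ) + (B (2*d+1) ((d:ℤ)-k) : Polynomial ℤ) := by
    intro k
    rw [show 2*(d+1)+0 = (2*d+1)+1 by ring, B_succ]
    push_cast
    congr 3; ring
  simp only [e1]
  simp only [mul_add (a _), add_mul, sum_add_distrib]
  rw [sum_range_succ (fun k => a k * (B (2*d+1) ((d:ℤ)-k) : Polynomial ℤ) * G 0 k) (d+1)]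
  rw [B_neg _ _ (by push_cast; omega)]
  rw [sum_range_succ' _ (d+1), mul_sum]
  have e2 : ∀ k : ℕ, (((d+1:ℕ):ℤ) - ((k+1:ℕ):ℤ)) = (d:ℤ) - k := by intro k; push_cast; ring
  have e3 : B (2*d+1) (((d+1:ℕ):ℤ) - ((0:ℕ):ℤ)) = 0 := by
    have := B_mid d
    simpa using this
  rw [e3]
  simp only [e2]
  have : ∀ k ∈ range (d+1), a (k+1) * (B (2*d+1) ((d:ℤ)-k) : Polynomial ℤ) * G 0 (k+1)
     + a k * (B (2*d+1) ((d:ℤ)-k) : Polynomial ℤ) * G 0 k =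
     (1 - X) * (a k * (B (2*d+1) ((d:ℤ)-k) : Polynomial ℤ) * G 1 k) := by
    intro k _
    have P := (PQ 0).2 k
    simp only [G_zero', zero_add] at P ⊢
    rw [a_succ]
    linear_combination a k * (B (2*d+1) ((d:ℤ)-k) : Polynomial ℤ) * P
  have := sum_congr rfl this
  rw [sum_add_distrib] at this
  push_cast
  linear_combination this

/-! combinatorics -/

lemma T_big (m h : ℕ) (hm : m < h) : T m h = 0 := by
  unfold T
  apply sum_eq_zero
  intro σ _
  rw [if_neg]
  rintro ⟨_, h2⟩
  have := card_le_univ (fixs σ)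
  simp at this; omega

lemma T_zero : T 0 0 = 1 := by
  have h1 : ∀ σ : Equiv.Perm (Fin 0), fixs σ = ∅ := fun σ => Finset.eq_empty_of_isEmpty _
  have h2 : ∀ σ : Equiv.Perm (Fin 0), w σ = 0 := fun σ => by
    unfold w; rw [Finset.eq_empty_of_isEmpty (filter _ _)]; simp
  simp [T, h1, h2]

lemma sum_rank {α : Type*} [LinearOrder α] (F : Finset α) :
    ∑ p ∈ F, (X : Polynomial ℤ) ^ (F.filter (· < p)).card = ∑ j ∈ range F.card, X ^ j := by
  induction F using Finset.induction_on_max with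
  | empty => simp
  | insert b s hb ih =>
    have hn : b ∉ s := fun h => lt_irrefl _ (hb b h)
    rw [sum_insert hn, card_insert_of_notMem hn, sum_range_succ, ← ih, add_comm]
    congr 1
    · apply sum_congr rfl
      intro p hp
      rw [filter_insert, if_neg (not_lt.2 (hb p hp).le)]
    · rw [filter_insert, if_neg (lt_irrefl _), filter_true_of_mem hb]

abbrev D {m : ℕ} (p : Fin (m+1)) (e : Equiv.Perm (Fin m)) : Equiv.Perm (Fin (m+1)) :=
  Equiv.Perm.decomposeFin.symm (p, e)

section
variable {m : ℕ} (e : Equiv.Perm (Fin m))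

lemma D0_zero : D 0 e 0 = 0 := by simp [D]
lemma D0_succ (i : Fin m) : D 0 e i.succ = (e i).succ := by
  simp [D]

lemma D0_inv : (∀ i, D 0 e (D 0 e i) = i) ↔ ∀ i, e (e i) = i := by
  rw [Fin.forall_fin_succ]
  simp only [D0_zero, D0_succ, Fin.succ_inj, true_and]

lemma card_fix {n : ℕ} (q : Fin n → Prop) [DecidablePred q] :
    (univ.filter q).card = ∑ i, if q i then 1 else 0 := by simp

lemma D0_fix : (fixs (D 0 e)).card = (fixs e).card + 1 := by
  unfold fixs
  rw [card_fix, card_fix, Fin.sum_univ_succ]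
  simp only [D0_zero, D0_succ, Fin.succ_inj, if_true]
  ring

lemma w_eq {n : ℕ} (σ : Equiv.Perm (Fin n)) : w σ = ∑ i, ∑ k,
    if i < k ∧ k < σ i ∧ (σ i < σ k ∨ σ k = k) then 1 else 0 := by
  unfold w
  rw [card_filter, Fintype.sum_prod_type]

lemma D0_w : w (D 0 e) = w e := by
  rw [w_eq, w_eq, Fin.sum_univ_succ]
  simp only [Fin.sum_univ_succ, D0_zero, D0_succ, Fin.succ_inj, Fin.succ_lt_succ_iff]
  simp

variable (p : Fin m)

lemma Dp_zero : D p.succ e 0 = p.succ := by simp [D]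
lemma Dp_succ (i : Fin m) : D p.succ e i.succ = if e i = p then 0 else (e i).succ := by
  simp only [D, Equiv.Perm.decomposeFin_symm_apply_succ]
  split_ifs with h
  · rw [h]; simp
  · rw [Equiv.swap_apply_of_ne_of_ne]
    · simp
    · simpa using h

lemma Dp_inv : (∀ i, D p.succ e (D p.succ e i) = i) ↔ ((∀ i, e (e i) = i) ∧ e p = p) := by
  rw [Fin.forall_fin_succ]
  simp only [Dp_zero, Dp_succ]
  constructor
  · rintro ⟨h1, h2⟩
    have hp : e p = p := by
      by_contra h
      rw [if_neg h] at h1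
      exact Fin.succ_ne_zero _ h1
    refine ⟨fun i => ?_, hp⟩
    have := h2 i
    by_cases hi : e i = p
    · have : i = p := e.injective (hi.trans hp.symm)
      rw [this, hp, hp]
    · rw [if_neg hi, Dp_succ] at this
      split_ifs at this with h3
      · exact absurd this.symm (Fin.succ_ne_zero _)
      · exact Fin.succ_injective _ this
  · rintro ⟨h1, hp⟩
    refine ⟨by simp [hp], fun i => ?_⟩
    by_cases hi : e i = p
    · have : i = p := e.injective (hi.trans hp.symm)
      rw [if_pos hi, Dp_zero, this]
    · rw [if_neg hi, Dp_succ, h1]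
      rw [if_neg]
      rintro rfl
      exact hi hp

variable {e p}

lemma Dp_fix (hp : e p = p) : (fixs (D p.succ e)).card + 1 = (fixs e).card := by
  have hi : ∀ i, e i = p ↔ i = p := fun i => ⟨fun h => e.injective (h.trans hp.symm), fun h => h ▸ hp⟩
  unfold fixs
  rw [card_fix, card_fix, Fin.sum_univ_succ]
  simp only [Dp_zero, Dp_succ, hi]
  rw [if_neg (Fin.succ_ne_zero _), zero_add]
  rw [Fintype.sum_eq_add_sum_compl p, Fintype.sum_eq_add_sum_compl p (fun i => if e i = i then 1 else 0)]
  simp only [hp, if_true]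
  rw [if_neg (Fin.succ_ne_zero _).symm, zero_add, add_comm]
  congr 1
  apply sum_congr rfl
  intro i h
  simp only [mem_compl, mem_singleton] at h
  simp [h]

lemma Dp_w (hp : e p = p) : w (D p.succ e) = w e + ((fixs e).filter (· < p)).card := by
  have hi : ∀ i, e i = p ↔ i = p := fun i => ⟨fun h => e.injective (h.trans hp.symm), fun h => h ▸ hp⟩
  have h0 : ((fixs e).filter (· < p)).card = ∑ k, if e k = k ∧ k < p then 1 else 0 := by
    unfold fixs; rw [filter_filter, card_filter]
  rw [w_eq, w_eq, Fin.sum_univ_succ, h0]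
  simp only [Fin.sum_univ_succ, Dp_zero, Dp_succ, hi]
  have z : ∀ i : Fin m, ¬ (i.succ < 0) := fun i => Fin.not_lt_zero _
  simp only [lt_irrefl, false_and, if_false, zero_add, z]
  have A : (∑ k : Fin m, if (0 : Fin (m+1)) < k.succ ∧ k.succ < p.succ ∧
      (p.succ < (if k = p then 0 else (e k).succ) ∨ (if k = p then 0 else (e k).succ) = k.succ)
      then 1 else 0) = (∑ k, if k < p ∧ p < e k then 1 else 0) +
        ∑ k, if e k = k ∧ k < p then 1 else 0 := by
    rw [← sum_add_distrib]
    apply sum_congr rfl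
    intro k _
    by_cases hk : k = p
    · subst hk; simp
    · simp only [hk, if_false, Fin.succ_lt_succ_iff, Fin.succ_inj, Fin.succ_pos, true_and]
      by_cases h1 : k < p <;> by_cases h2 : e k = k
      · simp [h1, h2, h1.le]
      · simp [h1, h2]
      · simp [h1]
      · simp [h1]
  have C : ∀ i : Fin m, (∑ k : Fin m, if i < k ∧ k < e i ∧ (e i < e k ∨ e k = k) then 1 else 0)
     = (if i < p ∧ p < e i then 1 else 0) +
      (∑ k : Fin m, if i.succ < k.succ ∧ k.succ < (if i = p then 0 else (e i).succ) ∧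
      ((if i = p then 0 else (e i).succ) < (if k = p then 0 else (e k).succ)
       ∨ (if k = p then 0 else (e k).succ) = k.succ) then 1 else 0) := by
    intro i
    by_cases hip : i = p
    · subst hip
      rw [hp]
      simp only [if_true, Fin.not_lt_zero, false_and, and_false, if_false, lt_irrefl]
      simp only [sum_const_zero, add_zero]
      apply sum_eq_zero
      intro k _
      rw [if_neg]
      rintro ⟨h1, h2, _⟩
      exact lt_asymm h1 h2
    · rw [Fintype.sum_eq_add_sum_compl p]
      rw [Fintype.sum_eq_add_sum_compl p (fun k : Fin m => if i.succ < k.succ ∧ k.succ < (if i = p then 0 else (e i).succ) ∧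
      ((if i = p then 0 else (e i).succ) < (if k = p then 0 else (e k).succ)
       ∨ (if k = p then 0 else (e k).succ) = k.succ) then 1 else 0)]
      simp only [hp, hip, if_true, if_false, or_true, and_true, Fin.not_lt_zero, false_or]
      have hz : ¬ (0 = p.succ) := fun h => Fin.succ_ne_zero p h.symm
      simp only [hz, and_false, if_false, zero_add]
      congr 1
      apply sum_congr rfl
      intro k h
      simp only [mem_compl, mem_singleton] at h
      simp [h]
  rw [A]
  simp only [C, sum_add_distrib]
  ring

end

lemma T_succ (m h : ℕ) : T (m+1) h =
    (∑ e : Equiv.Perm (Fin m), if (∀ i, e (e i) = i) ∧ (fixs e).card + 1 = h then X ^ w e else 0)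
    + (∑ j ∈ range (h+1), X ^ j) * T m (h+1) := by
  unfold T
  rw [← Equiv.sum_comp (Equiv.Perm.decomposeFin (n := m)).symm, Fintype.sum_prod_type,
    Fin.sum_univ_succ]
  congr 1
  · apply sum_congr rfl
    intro e _
    have h1 := D0_inv e
    have h2 := D0_fix e
    have h3 := D0_w e
    simp only [D] at h1 h2 h3
    simp only [h1, h2, h3]
  · rw [sum_comm, mul_sum]
    apply sum_congr rfl
    intro e _
    by_cases he : (∀ i, e (e i) = i) ∧ (fixs e).card = h + 1
    · rw [if_pos he, ← he.2, ← sum_rank, sum_mul]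
      unfold fixs
      rw [sum_filter]
      apply sum_congr rfl
      intro p _
      by_cases hp : e p = p
      · have h1 := Dp_inv e p
        have h2 := Dp_fix hp
        have h3 := Dp_w hp
        simp only [D] at h1 h2 h3
        rw [if_pos hp, if_pos ⟨h1.2 ⟨he.1, hp⟩, by have := he.2; unfold fixs at *; omega⟩, h3, pow_add, mul_comm]
        rfl
      · rw [if_neg hp, if_neg]
        rintro ⟨h4, _⟩
        exact hp ((Dp_inv e p).1 h4).2
    · rw [if_neg he, mul_zero]
      apply sum_eq_zero
      intro p _
      rw [if_neg]
      rintro ⟨h4, h5⟩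
      have h6 := (Dp_inv e p).1 h4
      have h7 := Dp_fix h6.2
      simp only [D] at h7
      exact he ⟨h6.1, by omega⟩

lemma T_rec0 (m : ℕ) : T (m+1) 0 = T m 1 := by
  rw [T_succ]; simp

lemma T_rec (m h : ℕ) : T (m+1) (h+1) = T m h + (∑ j ∈ range (h+2), X ^ j) * T m (h+2) := by
  rw [T_succ]; simp [T]

lemma main (m : ℕ) : ∀ d h, m = 2*d+h → (1-X)^d * T m h = V d h := by
  induction m with
  | zero =>
    intro d h hm
    obtain ⟨rfl, rfl⟩ : d = 0 ∧ h = 0 := by omega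
    simp [T_zero, V_zero]
  | succ m ih =>
    intro d h hm
    rcases h with _ | h
    · obtain ⟨d, rfl⟩ : ∃ d', d = d' + 1 := ⟨d-1, by omega⟩
      rw [T_rec0, V_rec0, ← ih d 1 (by omega)]; ring
    · rw [T_rec]
      rcases d with _ | d
      · rw [T_big m (h+2) (by omega), V_zero, ← V_zero h, ← ih 0 h (by omega)]; simp
      · rw [V_rec, ← ih (d+1) h (by omega), ← ih d (h+2) (by omega)]
        have := mul_neg_geom_sum (X : Polynomial ℤ) (h+2)
        rw [← this]; ring

end TR

/-- The Touchard–Riordan formula. -/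
theorem stmt0 (n : ℕ) :
    (1 - X) ^ n *
      ∑ σ ∈ Finset.univ.filter (fun σ : Equiv.Perm (Fin (2*n)) => IsMatching σ),
        (X : Polynomial ℤ) ^ cro σ
    = ∑ k ∈ Finset.range (n+1),
        (-1 : Polynomial ℤ) ^ k *
          ((ch (2*n) ((n : ℤ) - k) - ch (2*n) ((n : ℤ) - k - 1) : ℤ) : Polynomial ℤ) *
          X ^ (k * (k+1) / 2) := by
  have h := TR.main (2*n) n 0 (by ring)
  have e : TR.T (2*n) 0 = ∑ σ ∈ Finset.univ.filter (fun σ : Equiv.Perm (Fin (2*n)) => IsMatching σ),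
        (X : Polynomial ℤ) ^ cro σ := by
    unfold TR.T
    rw [sum_filter]
    apply sum_congr rfl
    intro σ _
    have h1 : (TR.fixs σ).card = 0 ↔ ∀ i, σ i ≠ i := by
      rw [card_eq_zero, TR.fixs, filter_eq_empty_iff]; simp
    by_cases hs : IsMatching σ
    · rw [if_pos hs, if_pos ⟨hs.1, h1.2 hs.2⟩]
      congr 1
      unfold TR.w cro
      congr 1
      apply filter_congr
      intro p _
      simp [hs.2 p.2]
    · rw [if_neg hs, if_neg]
      rintro ⟨h2, h3⟩
      exact hs ⟨h2, h1.1 h3⟩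
  rw [← e, h]
  unfold TR.V
  apply sum_congr rfl
  intro k _
  rw [TR.G_zero', TR.a, TR.B]
  simp only [add_zero]
  ring
end

section
/- For every natural number n, the following identity of polynomials in y and q holds: (1-q)^n · Σ_{σ ∈ S_n} y^{wex(σ)} q^{cro(σ)} = Σ_{k=0}^{n} (-1)^k · (Σ_{j=0}^{n-k} y^j · (C(n,j)·C(n,j+k) - C(n,j-1)·C(n,j+k+1))) · (Σ_{i=0}^{k} y^i · q^{i(k+1-i)}), where C(·,·) is the binomial coefficient (zero on negative arguments). -/
open Finset

/-- The number of weak exceedances of a permutation: indices `i` with `σ i ≥ i`. -/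
def wex {n : ℕ} (σ : Equiv.Perm (Fin n)) : ℕ :=
  (Finset.univ.filter (fun i : Fin n => i ≤ σ i)).card

/-- The number of crossings of a permutation: pairs `(i,k)` with
`i < k ≤ σ i < σ k` or `σ i < σ k < i < k`. -/
def croPerm {n : ℕ} (σ : Equiv.Perm (Fin n)) : ℕ :=
  (Finset.univ.filter (fun p : Fin n × Fin n =>
    (p.1 < p.2 ∧ p.2 ≤ σ p.1 ∧ σ p.1 < σ p.2) ∨
    (σ p.1 < σ p.2 ∧ σ p.2 < p.1 ∧ p.1 < p.2))).card

def ins {N : ℕ} (p v : Fin (N+1)) (σ : Equiv.Perm (Fin N)) : Equiv.Perm (Fin (N+1)) :=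
  (finSuccEquiv' p).trans ((Equiv.optionCongr σ).trans (finSuccEquiv' v).symm)

theorem ins_self {N : ℕ} (p v : Fin (N+1)) (σ : Equiv.Perm (Fin N)) : ins p v σ p = v := by
  simp [ins]

theorem ins_succ {N : ℕ} (p v : Fin (N+1)) (σ : Equiv.Perm (Fin N)) (i : Fin N) :
    ins p v σ (p.succAbove i) = v.succAbove (σ i) := by
  simp [ins]

theorem ins_inj {N : ℕ} {p v p' v' : Fin (N+1)} {σ σ' : Equiv.Perm (Fin N)}
    (h : ins p v σ = ins p' v' σ') (hp : p = p') (hv : v = v') : σ = σ' := by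
  subst hp hv
  ext i
  have := congrArg (fun τ => τ (p.succAbove i)) h
  simp only [ins_succ] at this
  rw [Fin.succAbove_right_injective this]

theorem sum_ins_v {R : Type*} [CommRing R] {N : ℕ} (p : Fin (N+1))
    (f : Equiv.Perm (Fin (N+1)) → R) :
    ∑ σ, f σ = ∑ v : Fin (N+1), ∑ σ : Equiv.Perm (Fin N), f (ins p v σ) := by
  rw [← Fintype.sum_prod_type']
  symm
  apply Fintype.sum_bijective (fun x : Fin (N+1) × Equiv.Perm (Fin N) => ins p x.1 x.2)
  · rw [Fintype.bijective_iff_injective_and_card]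
    constructor
    · rintro ⟨v, σ⟩ ⟨v', σ'⟩ h
      simp only at h
      have hv : v = v' := by
        rw [← ins_self p v σ, h, ins_self]
      rw [hv, ins_inj h rfl hv]
    · simp [Fintype.card_perm, Nat.factorial_succ]
  · intro x; rfl

theorem sum_ins_p {R : Type*} [CommRing R] {N : ℕ} (v : Fin (N+1))
    (f : Equiv.Perm (Fin (N+1)) → R) :
    ∑ σ, f σ = ∑ p : Fin (N+1), ∑ σ : Equiv.Perm (Fin N), f (ins p v σ) := by
  rw [← Fintype.sum_prod_type']
  symm
  apply Fintype.sum_bijective (fun x : Fin (N+1) × Equiv.Perm (Fin N) => ins x.1 v x.2)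
  · rw [Fintype.bijective_iff_injective_and_card]
    constructor
    · rintro ⟨v1, σ⟩ ⟨v', σ'⟩ h
      simp only at h
      have hv : v1 = v' := by
        apply (ins v1 v σ).injective
        rw [ins_self, h, ins_self]
      rw [hv, ins_inj h hv rfl]
    · simp [Fintype.card_perm, Nat.factorial_succ]
  · intro x; rfl

/-- crossing predicate -/
def crs {n : ℕ} (σ : Equiv.Perm (Fin n)) (i k : Fin n) : Prop :=
  (i < k ∧ k ≤ σ i ∧ σ i < σ k) ∨ (σ i < σ k ∧ σ k < i ∧ i < k)

instance {n : ℕ} (σ : Equiv.Perm (Fin n)) (i k : Fin n) : Decidable (crs σ i k) := by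
  unfold crs; infer_instance

theorem croPerm_eq {n : ℕ} (σ : Equiv.Perm (Fin n)) :
    croPerm σ = ∑ i, ∑ k, if crs σ i k then 1 else 0 := by
  rw [croPerm, Finset.card_filter, Fintype.sum_prod_type]
  rfl

theorem wex_eq {n : ℕ} (σ : Equiv.Perm (Fin n)) :
    wex σ = ∑ i, if i ≤ σ i then 1 else 0 := by
  rw [wex, Finset.card_filter]

def cnd {n : ℕ} (a b : ℕ) (σ : Equiv.Perm (Fin n)) : Prop :=
  ∀ i : Fin n, i.val < a → b ≤ (σ i).val

instance {n : ℕ} (a b : ℕ) (σ : Equiv.Perm (Fin n)) : Decidable (cnd a b σ) := by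
  unfold cnd; infer_instance

def wt {R : Type*} [CommRing R] (y q : R) {n : ℕ} (σ : Equiv.Perm (Fin n)) : R :=
  y ^ wex σ * q ^ croPerm σ

def ZZ {R : Type*} [CommRing R] (y q : R) (a b n : ℕ) : R :=
  ∑ σ : Equiv.Perm (Fin n), if cnd a b σ then wt y q σ else 0

theorem sA {N : ℕ} (p : Fin (N+1)) (i : Fin N) :
    ((p.succAbove i).val = i.val ∧ i.val < p.val) ∨
    ((p.succAbove i).val = i.val + 1 ∧ p.val ≤ i.val) := by
  unfold Fin.succAbove
  split_ifs with h
  · left; exact ⟨rfl, h⟩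
  · right; exact ⟨rfl, by simpa [Fin.lt_def] using h⟩

theorem cro_ins {N : ℕ} (p v : Fin (N+1)) (σ : Equiv.Perm (Fin N))
    (H : ∀ i k, crs (ins p v σ) (p.succAbove i) (p.succAbove k) ↔ crs σ i k) :
    croPerm (ins p v σ) = croPerm σ +
     ((∑ k, if crs (ins p v σ) p (p.succAbove k) then 1 else 0) +
      ∑ k, if crs (ins p v σ) (p.succAbove k) p then 1 else 0) := by
  rw [croPerm_eq, croPerm_eq, Fin.sum_univ_succAbove _ p, Fin.sum_univ_succAbove _ p]
  have : ¬ crs (ins p v σ) p p := by unfold crs; simp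
  rw [if_neg this]
  simp_rw [Fin.sum_univ_succAbove _ p, H, Finset.sum_add_distrib]
  ring

/-! step 1 : position `h`, value `v < h`. -/

theorem cnd1 {N h : ℕ} (hh : h < N + 1) (v : Fin (N+1)) (hv : v.val < h)
    (σ : Equiv.Perm (Fin N)) :
    cnd h h (ins ⟨h, hh⟩ v σ) ↔ cnd h (h-1) σ := by
  constructor
  · intro H i hi
    have h1 := H ((⟨h, hh⟩ : Fin (N+1)).succAbove i)
    rw [ins_succ] at h1
    have h2 := sA (⟨h, hh⟩ : Fin (N+1)) i
    have h3 := sA v (σ i)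
    simp only at h2
    have := h1 (by omega)
    omega
  · intro H i hi
    rcases Fin.eq_self_or_eq_succAbove (⟨h, hh⟩ : Fin (N+1)) i with h0 | ⟨j, rfl⟩
    · subst h0; simp at hi
    · rw [ins_succ]
      have h1 := H j
      have h2 := sA (⟨h, hh⟩ : Fin (N+1)) j
      have h3 := sA v (σ j)
      simp only at h2
      have := h1 (by omega)
      omega

theorem wex1 {N h : ℕ} (hh : h < N + 1) (v : Fin (N+1)) (hv : v.val < h)
    (σ : Equiv.Perm (Fin N)) (H : cnd h (h-1) σ) :
    wex (ins ⟨h, hh⟩ v σ) = wex σ := by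
  rw [wex_eq, wex_eq, Fin.sum_univ_succAbove _ ⟨h, hh⟩, ins_self, if_neg (by rw [Fin.le_def]; simpa using hv),
    zero_add]
  refine Finset.sum_congr rfl fun i _ => ?_
  rw [ins_succ]
  have h1 := H i
  have h2 := sA (⟨h, hh⟩ : Fin (N+1)) i
  have h3 := sA v (σ i)
  simp only at h2
  congr 1
  rw [Fin.le_def, Fin.le_def]
  apply propext
  by_cases hi : i.val < h
  · have := h1 hi; omega
  · omega

theorem cro1 {N h : ℕ} (hh : h < N + 1) (v : Fin (N+1)) (hv : v.val < h)
    (σ : Equiv.Perm (Fin N)) (H : cnd h (h-1) σ) :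
    croPerm (ins ⟨h, hh⟩ v σ) = croPerm σ + (h - 1 - v.val) := by
  rw [cro_ins]
  · congr 1
    have e2 : ∑ k, (if crs (ins ⟨h, hh⟩ v σ) ((⟨h, hh⟩ : Fin (N+1)).succAbove k) ⟨h, hh⟩ then 1 else 0) = 0 := by
      apply Finset.sum_eq_zero
      intro i _
      rw [if_neg]
      unfold crs
      rw [ins_succ, ins_self]
      have h1 := H i
      have h2 := sA (⟨h, hh⟩ : Fin (N+1)) i
      have h3 := sA v (σ i)
      simp only at h2
      simp only [Fin.le_def, Fin.lt_def]
      by_cases hi : i.val < h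
      · have := h1 hi; omega
      · omega
    have e1 : ∀ k, (crs (ins ⟨h, hh⟩ v σ) ⟨h, hh⟩ ((⟨h, hh⟩ : Fin (N+1)).succAbove k)) ↔
        (v.val ≤ (σ k).val ∧ (σ k).val < h - 1) := by
      intro i
      unfold crs
      rw [ins_succ, ins_self]
      have h1 := H i
      have h2 := sA (⟨h, hh⟩ : Fin (N+1)) i
      have h3 := sA v (σ i)
      simp only at h2
      simp only [Fin.le_def, Fin.lt_def]
      by_cases hi : i.val < h
      · have := h1 hi; omega
      · omega
    simp_rw [e2, e1, add_zero]
    rw [Equiv.sum_comp σ (fun w => if (v.val ≤ w.val ∧ w.val < h - 1) then 1 else 0)]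
    rw [Fin.sum_univ_eq_sum_range (fun w => if (v.val ≤ w ∧ w < h - 1) then 1 else 0) N,
      ← Finset.card_filter]
    have : (Finset.range N).filter (fun w => v.val ≤ w ∧ w < h - 1) = Finset.Ico v.val (h-1) := by
      ext w; simp; omega
    rw [this]; simp
  · intro i k
    unfold crs
    rw [ins_succ, ins_succ]
    have h1 := H i
    have h2 := sA (⟨h, hh⟩ : Fin (N+1)) i
    have h3 := sA v (σ i)
    have h1' := H k
    have h2' := sA (⟨h, hh⟩ : Fin (N+1)) k
    have h3' := sA v (σ k)
    simp only at h2 h2'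
    simp only [Fin.le_def, Fin.lt_def]
    by_cases hi : i.val < h <;> by_cases hk : k.val < h <;> simp only [hi, hk, true_implies, false_implies] at h1 h1' <;> omega

/-! step 2 : position `p ≤ h`, value `h`. -/

theorem cnd2 {N h : ℕ} (hh : h < N + 1) (p : Fin (N+1)) (hp : p.val ≤ h)
    (σ : Equiv.Perm (Fin N)) :
    cnd (h+1) h (ins p ⟨h, hh⟩ σ) ↔ cnd h h σ := by
  constructor
  · intro H i hi
    have h1 := H (p.succAbove i)
    rw [ins_succ] at h1
    have h2 := sA (⟨h, hh⟩ : Fin (N+1)) (σ i)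
    have h3 := sA p i
    simp only at h2
    have := h1 (by omega)
    omega
  · intro H i hi
    rcases Fin.eq_self_or_eq_succAbove p i with h0 | ⟨j, rfl⟩
    · subst h0; rw [ins_self]
    · rw [ins_succ]
      have h1 := H j
      have h2 := sA (⟨h, hh⟩ : Fin (N+1)) (σ j)
      have h3 := sA p j
      simp only at h2
      have := h1 (by omega)
      omega

theorem wex2 {N h : ℕ} (hh : h < N + 1) (p : Fin (N+1)) (hp : p.val ≤ h)
    (σ : Equiv.Perm (Fin N)) (H : cnd h h σ) :
    wex (ins p ⟨h, hh⟩ σ) = wex σ + 1 := by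
  rw [wex_eq, wex_eq, Fin.sum_univ_succAbove _ p, ins_self, if_pos (by rw [Fin.le_def]; simpa using hp),
    add_comm]
  congr 1
  refine Finset.sum_congr rfl fun i _ => ?_
  rw [ins_succ]
  have h1 := H i
  have h2 := sA (⟨h, hh⟩ : Fin (N+1)) (σ i)
  have h3 := sA p i
  simp only at h2
  congr 1
  rw [Fin.le_def, Fin.le_def]
  apply propext
  by_cases hi : i.val < h
  · have := h1 hi; omega
  · omega

theorem cro2 {N h : ℕ} (hh : h < N + 1) (p : Fin (N+1)) (hp : p.val ≤ h)
    (σ : Equiv.Perm (Fin N)) (H : cnd h h σ) :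
    croPerm (ins p ⟨h, hh⟩ σ) = croPerm σ + (h - p.val) := by
  rw [cro_ins]
  · congr 1
    have e2 : ∑ k, (if crs (ins p ⟨h, hh⟩ σ) (p.succAbove k) p then 1 else 0) = 0 := by
      apply Finset.sum_eq_zero
      intro i _
      rw [if_neg]
      unfold crs
      rw [ins_succ, ins_self]
      have h1 := H i
      have h2 := sA (⟨h, hh⟩ : Fin (N+1)) (σ i)
      have h3 := sA p i
      simp only at h2
      simp only [Fin.le_def, Fin.lt_def]
      by_cases hi : i.val < h
      · have := h1 hi; omega
      · omega
    have e1 : ∀ k, (crs (ins p ⟨h, hh⟩ σ) p (p.succAbove k)) ↔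
        (p.val ≤ k.val ∧ k.val < h) := by
      intro i
      unfold crs
      rw [ins_succ, ins_self]
      have h1 := H i
      have h2 := sA (⟨h, hh⟩ : Fin (N+1)) (σ i)
      have h3 := sA p i
      simp only at h2
      simp only [Fin.le_def, Fin.lt_def]
      by_cases hi : i.val < h
      · have := h1 hi; omega
      · omega
    simp_rw [e2, e1, add_zero]
    rw [Fin.sum_univ_eq_sum_range (fun w => if (p.val ≤ w ∧ w < h) then 1 else 0) N,
      ← Finset.card_filter]
    have : (Finset.range N).filter (fun w => p.val ≤ w ∧ w < h) = Finset.Ico p.val h := by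
      ext w; simp; omega
    rw [this]; simp
  · intro i k
    unfold crs
    rw [ins_succ, ins_succ]
    have h1 := H i
    have h2 := sA (⟨h, hh⟩ : Fin (N+1)) (σ i)
    have h3 := sA p i
    have h1' := H k
    have h2' := sA (⟨h, hh⟩ : Fin (N+1)) (σ k)
    have h3' := sA p k
    simp only at h2 h2'
    simp only [Fin.le_def, Fin.lt_def]
    by_cases hi : i.val < h <;> by_cases hk : k.val < h <;> simp only [hi, hk, true_implies, false_implies] at h1 h1' <;> omega

theorem sum_fin_ite {R : Type*} [CommRing R] (N h : ℕ) (hh : h ≤ N) (f : ℕ → R) :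
    ∑ v : Fin N, (if v.val < h then f v.val else 0) = ∑ v ∈ Finset.range h, f v := by
  rw [Fin.sum_univ_eq_sum_range (fun v => if v < h then f v else 0) N, ← Finset.sum_filter]
  congr 1
  ext w; simp; omega

theorem Z_step1 {R : Type*} [CommRing R] (y q : R) (h N : ℕ) (hh : h < N + 1) :
    ZZ y q h h (N+1) = ZZ y q (h+1) h (N+1) +
      (∑ v ∈ Finset.range h, q ^ (h-1-v)) * ZZ y q h (h-1) N := by
  rw [← sum_fin_ite (N+1) h (by omega), Finset.sum_mul]
  unfold ZZ
  rw [sum_ins_v ⟨h, hh⟩, sum_ins_v ⟨h, hh⟩, ← Finset.sum_add_distrib]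
  refine Finset.sum_congr rfl fun v _ => ?_
  by_cases hv : v.val < h
  · rw [if_pos hv, Finset.mul_sum, ← Finset.sum_add_distrib]
    refine Finset.sum_congr rfl fun σ _ => ?_
    have : ¬ cnd (h+1) h (ins ⟨h, hh⟩ v σ) := by
      intro H
      have := H ⟨h, hh⟩ (by simp)
      rw [ins_self] at this
      omega
    rw [if_neg this, zero_add]
    by_cases hc : cnd h (h-1) σ
    · rw [if_pos hc, if_pos ((cnd1 hh v hv σ).2 hc), wt, wt, wex1 hh v hv σ hc, cro1 hh v hv σ hc]
      ring
    · rw [if_neg hc, if_neg (fun H => hc ((cnd1 hh v hv σ).1 H)), mul_zero]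
  · rw [if_neg hv, zero_mul, add_zero]
    refine Finset.sum_congr rfl fun σ _ => ?_
    congr 1
    apply propext
    constructor
    · intro H i hi
      by_cases h0 : i.val = h
      · have : i = ⟨h, hh⟩ := Fin.ext h0
        rw [this, ins_self]; omega
      · exact H i (by omega)
    · intro H i hi
      exact H i (by omega)

theorem Z_step2 {R : Type*} [CommRing R] (y q : R) (h N : ℕ) (hh : h < N + 1) :
    ZZ y q (h+1) h (N+1) = ZZ y q (h+1) (h+1) (N+1) +
      y * (∑ v ∈ Finset.range (h+1), q ^ (h-v)) * ZZ y q h h N := by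
  rw [← sum_fin_ite (N+1) (h+1) (by omega), Finset.mul_sum, Finset.sum_mul]
  unfold ZZ
  rw [sum_ins_p ⟨h, hh⟩, sum_ins_p ⟨h, hh⟩, ← Finset.sum_add_distrib]
  refine Finset.sum_congr rfl fun v _ => ?_
  by_cases hv : v.val < h + 1
  · rw [if_pos hv, Finset.mul_sum, ← Finset.sum_add_distrib]
    refine Finset.sum_congr rfl fun σ _ => ?_
    have hv' : v.val ≤ h := by omega
    have : ¬ cnd (h+1) (h+1) (ins v ⟨h, hh⟩ σ) := by
      intro H
      have := H v (by omega)
      rw [ins_self] at this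
      simp at this
    rw [if_neg this, zero_add]
    by_cases hc : cnd h h σ
    · rw [if_pos hc, if_pos ((cnd2 hh v hv' σ).2 hc), wt, wt, wex2 hh v hv' σ hc, cro2 hh v hv' σ hc]
      ring
    · rw [if_neg hc, if_neg (fun H => hc ((cnd2 hh v hv' σ).1 H)), mul_zero]
  · rw [if_neg hv, mul_zero, zero_mul, add_zero]
    refine Finset.sum_congr rfl fun σ _ => ?_
    congr 1
    apply propext
    constructor
    · intro H i hi
      have h1 := H i hi
      rcases Fin.eq_self_or_eq_succAbove v i with h0 | ⟨j, rfl⟩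
      · omega
      · rw [ins_succ] at h1 ⊢
        have h2 := sA (⟨h, hh⟩ : Fin (N+1)) (σ j)
        simp only at h2
        omega
    · intro H i hi
      have := H i hi
      omega

section alg
variable {R : Type*} [CommRing R] (y q : R)

def gg (h r : ℕ) : R := (1 - q) ^ (r + h) * ZZ y q h h (h + r)

theorem geo (h : ℕ) : (1 - q) * (∑ v ∈ Finset.range (h+1), q ^ (h-v)) = 1 - q ^ (h+1) := by
  have := Finset.sum_range_reflect (fun v => q ^ v) (h+1)
  simp only [Nat.add_sub_cancel] at this
  have e : ∀ v, h + 1 - 1 - v = h - v := fun v => by omega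
  rw [this, mul_neg_geom_sum]

theorem gg_zero (r : ℕ) : gg y q 0 (r+1) = gg y q 1 r + y * (1 - q) * gg y q 0 r := by
  unfold gg
  have h1 := Z_step1 y q 0 r (by omega)
  have h2 := Z_step2 y q 0 r (by omega)
  simp only [Finset.range_zero, Finset.sum_empty, zero_mul, add_zero] at h1
  simp only [zero_add, Finset.sum_range_one, Nat.sub_zero, pow_zero, mul_one] at h1 h2 ⊢
  rw [h1, h2, show 1 + r = r + 1 by ring]
  simp only [add_zero]
  ring

theorem gg_succ (h r : ℕ) : gg y q (h+1) (r+1) = gg y q (h+2) r +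
    (y * (1 - q^(h+2)) + (1 - q^(h+1))) * gg y q (h+1) r + y * (1 - q^(h+1))^2 * gg y q h r := by
  unfold gg
  have h1 := Z_step1 y q (h+1) (h+r+1) (by omega)
  have h2 := Z_step2 y q (h+1) (h+r+1) (by omega)
  have h3 := Z_step2 y q h (h+r) (by omega)
  simp only [Nat.add_sub_cancel] at h1
  rw [show h + 1 + (r+1) = h + r + 1 + 1 by ring, show h + 2 + r = h + r + 1 + 1 by ring,
    show h + 1 + r = h + r + 1 by ring, h1, h2, h3, ← geo q h, ← geo q (h+1)]
  ring

def PP (h a : ℕ) : R := ∏ s ∈ Finset.range h, (1 - q ^ (a + s + 1))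

theorem PP_succ (h a : ℕ) : PP q (h+1) a = PP q h a * (1 - q ^ (a + h + 1)) := by
  unfold PP; rw [Finset.prod_range_succ]

theorem PP_succ' (h a : ℕ) : PP q (h+1) a = (1 - q ^ (a + 1)) * PP q h (a+1) := by
  unfold PP; rw [Finset.prod_range_succ', mul_comm]
  congr 1
  refine Finset.prod_congr rfl fun s _ => ?_
  rw [show a + (s+1) + 1 = a + 1 + s + 1 by ring]

def ww (h a b : ℕ) : R := q ^ (a * (b+1)) * PP q h a * PP q h b

def opA (f : ℕ → ℕ → R) : ℕ → ℕ → R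
  | 0, _ => 0
  | a+1, b => f a b
def opB (f : ℕ → ℕ → R) : ℕ → ℕ → R
  | _, 0 => 0
  | a, b+1 => f a b

theorem ww_succ (h a b : ℕ) :
    opA (opB (ww q (h+2))) a b + q^(h+2) * opA (ww q (h+1)) a b + q^(h+1) * opB (ww q (h+1)) a b
     + (1 - q^(h+1))^2 * ww q h a b = ww q (h+1) a b + opA (opB (ww q (h+1))) a b := by
  rcases a with _ | a <;> rcases b with _ | b
  · simp only [opA, opB, ww, PP_succ]; ring
  · simp only [opA, opB, ww]
    rw [PP_succ' q h b, PP_succ, PP_succ]; ring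
  · simp only [opA, opB, ww]
    rw [PP_succ' q h a, PP_succ, PP_succ]; ring
  · simp only [opA, opB, ww]
    rw [PP_succ' q (h+1) a, PP_succ' q (h+1) b, PP_succ' q h a, PP_succ' q h b, PP_succ q h (a+1),
      PP_succ q h (b+1)]; ring

theorem ww_zero (a b : ℕ) (hab : a + b ≠ 0) :
    opA (opB (ww q 1)) a b + q * opA (ww q 0) a b + opB (ww q 0) a b
     = ww q 0 a b + opA (opB (ww q 0)) a b := by
  rcases a with _ | a <;> rcases b with _ | b
  · simp at hab
  all_goals simp [opA, opB, ww, PP] <;> ring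

def sm (f : ℕ → ℕ → R) (e : ℕ) : R := ∑ x ∈ Finset.HasAntidiagonal.antidiagonal e, y ^ x.1 * f x.1 x.2

theorem smA0 (f : ℕ → ℕ → R) : sm y (opA f) 0 = 0 := by simp [sm, opA]
theorem smB0 (f : ℕ → ℕ → R) : sm y (opB f) 0 = 0 := by simp [sm, opB]
theorem smA (f : ℕ → ℕ → R) (e : ℕ) : sm y (opA f) (e+1) = y * sm y f e := by
  unfold sm
  rw [Finset.Nat.sum_antidiagonal_succ, Finset.mul_sum]
  simp only [opA, mul_zero, zero_add]
  refine Finset.sum_congr rfl fun x _ => ?_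
  ring
theorem smB (f : ℕ → ℕ → R) (e : ℕ) : sm y (opB f) (e+1) = sm y f e := by
  unfold sm
  rw [Finset.Nat.sum_antidiagonal_succ']
  simp only [opB, mul_zero, zero_add]

theorem sm_succ (h e : ℕ) :
    sm y (opA (opB (ww q (h+2)))) e + q^(h+2) * sm y (opA (ww q (h+1))) e
     + q^(h+1) * sm y (opB (ww q (h+1))) e
     + (1 - q^(h+1))^2 * sm y (ww q h) e
     = sm y (ww q (h+1)) e + sm y (opA (opB (ww q (h+1)))) e := by
  unfold sm
  simp only [Finset.mul_sum, ← Finset.sum_add_distrib]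
  refine Finset.sum_congr rfl fun x _ => ?_
  linear_combination y ^ x.1 * ww_succ q h x.1 x.2

theorem sm_zero (e : ℕ) :
    sm y (opA (opB (ww q 1))) (e+1) + q * sm y (opA (ww q 0)) (e+1) + sm y (opB (ww q 0)) (e+1)
     = sm y (ww q 0) (e+1) + sm y (opA (opB (ww q 0))) (e+1) := by
  unfold sm
  simp only [Finset.mul_sum, ← Finset.sum_add_distrib]
  refine Finset.sum_congr rfl fun x hx => ?_
  linear_combination y ^ x.1 * ww_zero q x.1 x.2 (by
    rw [Finset.HasAntidiagonal.mem_antidiagonal] at hx; omega)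

def sm1 (f : ℕ → ℕ → R) : ℕ → R
  | 0 => 0
  | e+1 => sm y f e

def vs (h K : ℕ) : R := (-1) ^ (K + 1 + h) * y ^ h * sm1 y (ww q h) (K - h)

theorem vs_zero (K : ℕ) :
    vs y q 1 (K+1) + y * (1 - q) * vs y q 0 (K+1) =
    vs y q 0 (K+2) + (1 + y) * vs y q 0 (K+1) + y * vs y q 0 K := by
  rcases K with _ | K
  · have := sm_zero y q 0
    simp only [smA, smB, smB0] at this
    simp only [vs, sm1, Nat.sub_zero, Nat.sub_self, zero_add]
    linear_combination - this
  · have := sm_zero y q (K+1)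
    simp only [smA, smB] at this
    simp only [vs, sm1, Nat.sub_zero, Nat.add_sub_cancel]
    linear_combination (-1)^K * this

theorem vs_succ (h K : ℕ) :
    vs y q (h+2) (K+1) + (y * (1 - q^(h+2)) + (1 - q^(h+1))) * vs y q (h+1) (K+1)
      + y * (1 - q^(h+1))^2 * vs y q h (K+1) =
    vs y q (h+1) (K+2) + (1 + y) * vs y q (h+1) (K+1) + y * vs y q (h+1) K := by
  unfold vs
  rcases lt_or_ge K h with hk | hk
  · rw [show K + 1 - (h+2) = 0 by omega, show K + 1 - (h+1) = 0 by omega,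
      show K + 1 - h = 0 by omega, show K + 2 - (h+1) = 0 by omega, show K - (h+1) = 0 by omega]
    simp [sm1]
  · obtain ⟨e, rfl⟩ := Nat.exists_eq_add_of_le hk
    rw [show h + e + 1 - (h+2) = e - 1 by omega, show h + e + 1 - (h+1) = e by omega,
      show h + e + 1 - h = e + 1 by omega, show h + e + 2 - (h+1) = e + 1 by omega,
      show h + e - (h+1) = e - 1 by omega]
    have hs : ∀ m : ℕ, ((-1 : R)) ^ (m * 2) = 1 := fun m => by rw [mul_comm, pow_mul]; simp
    have := sm_succ y q h e
    rcases e with _ | _ | e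
    · simp only [smA0, smB0] at this
      simp only [sm1, Nat.zero_sub]
      linear_combination (-1) ^ (h + 0 + 1 + 1 + h) * y ^ (h+1) * this
    · simp only [smA, smB, smB0] at this
      simp only [sm1, zero_add, Nat.sub_self]
      linear_combination (-1) ^ (h + 1 + 1 + 1 + h) * y ^ (h+1) * this
    · simp only [smA, smB] at this
      simp only [sm1, Nat.add_sub_cancel]
      linear_combination (-1) ^ (h + (e+2) + 1 + 1 + h) * y ^ (h+1) * this

theorem ch_pascal (n : ℕ) (j : ℤ) : ch (n+1) j = ch n j + ch n (j-1) := by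
  unfold ch
  rcases lt_trichotomy j 0 with h | h | h
  · rw [if_neg (by omega), if_neg (by omega), if_neg (by omega)]; simp
  · subst h; simp
  · rw [if_pos (by omega), if_pos (by omega), if_pos (by omega)]
    obtain ⟨m, rfl⟩ : ∃ m : ℕ, j = m + 1 := ⟨(j-1).toNat, by omega⟩
    rw [show ((m:ℤ)+1).toNat = m + 1 by omega, show ((m:ℤ)+1-1).toNat = m by omega,
      Nat.choose_succ_succ]
    push_cast; ring

theorem ch_neg (n : ℕ) (j : ℤ) (h : j < 0) : ch n j = 0 := by
  unfold ch; rw [if_neg (by omega)]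

theorem ch_big (n : ℕ) (j : ℤ) (h : (n:ℤ) < j) : ch n j = 0 := by
  unfold ch; rw [if_pos (by omega), Nat.choose_eq_zero_of_lt (by omega)]; rfl

def aa (n : ℕ) (k j : ℤ) : ℤ := ch n j * ch n (j+k) - ch n (j-1) * ch n (j+k+1)

theorem aa_succ (n : ℕ) (k j : ℤ) :
    aa (n+1) k j = aa n (k-1) j + aa n k j + aa n k (j-1) + aa n (k+1) (j-1) := by
  unfold aa
  simp only [ch_pascal n]
  rw [show j + (k-1) = j + k - 1 by ring, show j + k - 1 + 1 = j + k by ring,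
    show j + k + 1 - 1 = j + k by ring, show j - 1 + k = j + k - 1 by ring,
    show j - 1 + (k+1) = j + k by ring,  show j + k - 1 + 1 = j + k by ring]
  ring

def cc (n : ℕ) (k : ℤ) : R := ∑ j ∈ Finset.range (n+1), y ^ j * ((aa n k j : ℤ) : R)

theorem aa_zero (n : ℕ) (k j : ℤ) (hk : -1 ≤ k) (h : (n:ℤ) < j + k) (hj : 0 ≤ j): aa n k j = 0 := by
  unfold aa
  rw [ch_big n (j+k) h, ch_big n (j+k+1) (by omega)]; simp

theorem aa_neg_one (n : ℕ) (j : ℤ) : aa n (-1) j = 0 := by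
  unfold aa
  rw [show j + -1 + 1 = j by ring, show j + -1 = j - 1 by ring]; ring

theorem aa_j (n : ℕ) (k : ℤ) : aa n k (-1) = 0 := by
  unfold aa
  rw [ch_neg n (-1) (by omega), ch_neg n (-1-1) (by omega)]; ring

theorem cc_ext (n M : ℕ) (k : ℤ) (hk : -1 ≤ k) :
    cc y n k = ∑ j ∈ Finset.range (n+1+M), y ^ j * ((aa n k j : ℤ) : R) := by
  rw [Finset.sum_range_add, cc, left_eq_add]
  apply Finset.sum_eq_zero
  intro j _
  rcases eq_or_lt_of_le hk with h | h
  · rw [← h, aa_neg_one]; simp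
  · rw [aa_zero n k _ hk (by push_cast; omega) (by positivity)]; simp

theorem cc_shift (n : ℕ) (k : ℤ) (hk : -1 ≤ k) :
    y * cc y n k = ∑ j ∈ Finset.range (n+2), y ^ j * ((aa n k ((j:ℤ)-1) : ℤ) : R) := by
  rw [Finset.sum_range_succ', cc, Finset.mul_sum]
  simp only [Nat.cast_zero, zero_sub, aa_j, Int.cast_zero, mul_zero, add_zero]
  refine Finset.sum_congr rfl fun j _ => ?_
  rw [show ((j+1:ℕ):ℤ) - 1 = j by push_cast; ring]
  ring

theorem cc_succ (n : ℕ) (k : ℤ) (hk : 0 ≤ k) :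
    cc y (n+1) k = cc y n (k-1) + (1 + y) * cc y n k + y * cc y n (k+1) := by
  rw [add_mul, one_mul, cc_shift y n k (by omega), cc_shift y n (k+1) (by omega),
    cc_ext y n 1 (k-1) (by omega), cc_ext y n 1 k (by omega), cc]
  simp only [← Finset.sum_add_distrib, add_assoc, Nat.reduceAdd]
  refine Finset.sum_congr rfl fun j _ => ?_
  rw [aa_succ]
  push_cast
  ring

theorem cc_big (n : ℕ) (k : ℤ) (hk : (n:ℤ) < k) : cc y n k = 0 := by
  apply Finset.sum_eq_zero
  intro j _
  rw [aa_zero n k _ (by omega) (by omega) (by omega)]; simp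

theorem cc_neg (n : ℕ) : cc y n (-1) = 0 := by
  apply Finset.sum_eq_zero
  intro j _
  rw [aa_neg_one]; simp

theorem sum_rec (n : ℕ) (f : ℕ → R) (hf : f 0 = 0) :
    ∑ k ∈ Finset.range (n+1), cc y n k * (f (k+2) + (1 + y) * f (k+1) + y * f k) =
    ∑ k ∈ Finset.range (n+2), cc y (n+1) k * f (k+1) := by
  have e1 : ∑ k ∈ Finset.range (n+2), cc y n ((k:ℤ)-1) * f (k+1) =
      ∑ k ∈ Finset.range (n+1), cc y n k * f (k+2) := by
    rw [Finset.sum_range_succ']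
    simp [cc_neg]
  have e2 : ∑ k ∈ Finset.range (n+2), cc y n (k:ℤ) * f (k+1) =
      ∑ k ∈ Finset.range (n+1), cc y n k * f (k+1) := by
    rw [Finset.sum_range_succ, cc_big y n _ (by push_cast; omega)]
    simp
  have e3 : ∑ k ∈ Finset.range (n+2), cc y n ((k:ℤ)+1) * f (k+1) =
      ∑ k ∈ Finset.range (n+1), cc y n k * f k := by
    rw [Finset.sum_range_succ, cc_big y n _ (by push_cast; omega), Finset.sum_range_succ,
      cc_big y n _ (by omega), Finset.sum_range_succ' _ n, hf]
    simp
  have : ∀ k ∈ Finset.range (n+2), cc y (n+1) k * f (k+1) =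
     cc y n ((k:ℤ)-1) * f (k+1) + (1+y) * (cc y n (k:ℤ) * f (k+1)) + y * (cc y n ((k:ℤ)+1) * f (k+1)) := by
    intro k _
    rw [cc_succ y n k (by omega)]; ring
  rw [Finset.sum_congr rfl this]
  simp only [Finset.sum_add_distrib, ← Finset.mul_sum, e1, e2, e3]
  simp only [Finset.mul_sum, ← Finset.sum_add_distrib]
  refine Finset.sum_congr rfl fun k _ => ?_
  ring

theorem vs_K0 (h : ℕ) : vs y q h 0 = 0 := by simp [vs, sm1]

theorem main_g (n : ℕ) : ∀ h, gg y q h n = ∑ k ∈ Finset.range (n+1), cc y n k * vs y q h (k+1) := by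
  induction n with
  | zero =>
    intro h
    rw [zero_add, Finset.sum_range_one]
    have : cc y 0 ((0:ℕ):ℤ) = 1 := by simp [cc, aa, ch]
    rw [this, one_mul]
    rcases h with _ | h
    · simp [gg, vs, sm1, sm, ww, PP, ZZ, wt, cnd, wex, croPerm]
    · have : ZZ y q (h+1) (h+1) (h+1) = 0 := by
        apply Finset.sum_eq_zero
        intro σ _
        rw [if_neg]
        intro H
        have := H 0 (by simp)
        omega
      simp [gg, this, vs, sm1]
  | succ n ih =>
    intro h
    rw [← sum_rec y n (fun K => vs y q h K) (vs_K0 y q h)]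
    rcases h with _ | h
    · rw [gg_zero, ih, ih, Finset.mul_sum, ← Finset.sum_add_distrib]
      refine Finset.sum_congr rfl fun k _ => ?_
      linear_combination cc y n k * vs_zero y q k
    · rw [gg_succ, ih, ih, ih, Finset.mul_sum, Finset.mul_sum, ← Finset.sum_add_distrib,
        ← Finset.sum_add_distrib]
      refine Finset.sum_congr rfl fun k _ => ?_
      linear_combination cc y n k * vs_succ y q h k

theorem main_R (n : ℕ) :
    (1 - q) ^ n * ∑ σ : Equiv.Perm (Fin n), y ^ wex σ * q ^ croPerm σ
    = ∑ k ∈ Finset.range (n+1), (-1 : R) ^ k *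
        (∑ j ∈ Finset.range (n-k+1), y ^ j *
            ((ch n (j : ℤ) * ch n ((j : ℤ) + k)
              - ch n ((j : ℤ) - 1) * ch n ((j : ℤ) + k + 1) : ℤ) : R)) *
        (∑ i ∈ Finset.range (k+1), y ^ i * q ^ (i * (k + 1 - i))) := by
  have h0 := main_g y q n 0
  have h1 : gg y q 0 n = (1 - q) ^ n * ∑ σ : Equiv.Perm (Fin n), y ^ wex σ * q ^ croPerm σ := by
    rw [gg, zero_add, add_zero]; simp [ZZ, cnd, wt]
  rw [← h1, h0]
  refine Finset.sum_congr rfl fun k hk => ?_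
  rw [Finset.mem_range] at hk
  have h2 : vs y q 0 (k+1) = (-1)^k * ∑ i ∈ Finset.range (k+1), y ^ i * q ^ (i * (k + 1 - i)) := by
    rw [vs, Nat.sub_zero, sm1, sm, Finset.Nat.sum_antidiagonal_eq_sum_range_succ_mk]
    congr 1
    · ring
    · refine Finset.sum_congr rfl fun i hi => ?_
      rw [Finset.mem_range] at hi
      simp only [ww, PP, Finset.range_zero, Finset.prod_empty, mul_one]
      rw [show k - i + 1 = k + 1 - i by omega]
  have h3 : cc y n (k:ℤ) = ∑ j ∈ Finset.range (n-k+1), y ^ j * ((aa n k j : ℤ) : R) := by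
    rw [cc, show n + 1 = (n - k + 1) + k by omega, Finset.sum_range_add, add_eq_left]
    apply Finset.sum_eq_zero
    intro j _
    rw [aa_zero n k _ (by omega) (by push_cast; omega) (by positivity)]; simp
  rw [h2, h3]
  unfold aa
  ring

end alg

open MvPolynomial in
/-- Formula for the weak exceedance/crossing generating function of permutations.
Here `y = X 0` and `q = X 1`. -/
theorem stmt3 (n : ℕ) :
    (1 - X 1) ^ n *
      ∑ σ : Equiv.Perm (Fin n),
        (X 0 : MvPolynomial (Fin 2) ℤ) ^ wex σ * (X 1) ^ croPerm σ
    = ∑ k ∈ Finset.range (n+1),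
        (-1 : MvPolynomial (Fin 2) ℤ) ^ k *
        (∑ j ∈ Finset.range (n-k+1),
          (X 0 : MvPolynomial (Fin 2) ℤ) ^ j *
            ((ch n (j : ℤ) * ch n ((j : ℤ) + k)
              - ch n ((j : ℤ) - 1) * ch n ((j : ℤ) + k + 1) : ℤ) :
                MvPolynomial (Fin 2) ℤ)) *
        (∑ i ∈ Finset.range (k+1),
          (X 0 : MvPolynomial (Fin 2) ℤ) ^ i * (X 1) ^ (i * (k + 1 - i))) := by
  exact main_R (X 0) (X 1) n
end
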